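/- arXiv:1910.01984 — 5 statements merged into one kernel-verified Lean document; each statement's English description precedes it below -/
import Mathlib

section
/- The Kerr metric is reconstructed from the principal null tetrad: denoting by v♭ = G·v the covector (4×1 column) obtained by applying the Kerr metric matrix G to a tetrad vector v, one has the 4×4 matrix identity G = ℓ̃♭ (ñ♭)ᵀ + ñ♭ (ℓ̃♭)ᵀ − m̃♭ (m̄̃♭)ᵀ − m̄̃♭ (m̃♭)ᵀ, valid for all r, θ with Σ > 0, Δ ≠ 0, sin θ ≠ 0 and 𝔯 ≠ 0. -/
noncomputable section

namespace Stmt1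

/-- Σ = r² + a² cos²θ -/
def Sigk (a r θ : ℝ) : ℝ := r ^ 2 + a ^ 2 * Real.cos θ ^ 2

/-- Δ = r² − 2Mr + a² -/
def Delk (M a r : ℝ) : ℝ := r ^ 2 - 2 * M * r + a ^ 2

/-- Φ = 2Mr/Σ -/
def Phik (M a r θ : ℝ) : ℝ := 2 * M * r / Sigk a r θ

/-- The Kerr metric in Boyer–Lindquist coordinates, as a symmetric 4×4 matrix
in the coordinate basis (∂_t, ∂_r, ∂_θ, ∂_φ), extended complex-bilinearly. -/
def kerrMetric (M a r θ : ℝ) : Matrix (Fin 4) (Fin 4) ℂ :=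
  !![((1 - Phik M a r θ : ℝ) : ℂ), 0, 0, ((Phik M a r θ * a * Real.sin θ ^ 2 : ℝ) : ℂ);
     0, ((-(Sigk a r θ / Delk M a r) : ℝ) : ℂ), 0, 0;
     0, 0, ((-Sigk a r θ : ℝ) : ℂ), 0;
     ((Phik M a r θ * a * Real.sin θ ^ 2 : ℝ) : ℂ), 0, 0,
       ((-((r ^ 2 + a ^ 2 + Phik M a r θ * a ^ 2 * Real.sin θ ^ 2) * Real.sin θ ^ 2) : ℝ) : ℂ)]

/-- Complex-bilinear contraction g(v,w) of two (complexified) tangent vectors. -/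
def gdot (G : Matrix (Fin 4) (Fin 4) ℂ) (v w : Fin 4 → ℂ) : ℂ :=
  ∑ i : Fin 4, ∑ j : Fin 4, v i * G i j * w j

/-- 𝔯 = r + i a cosθ -/
def rfrak (a r θ : ℝ) : ℂ := (r : ℂ) + Complex.I * a * Real.cos θ

/-- Outgoing principal null vector ℓ̃. -/
def tildeL (M a r : ℝ) : Fin 4 → ℂ :=
  ![(((r ^ 2 + a ^ 2) / Delk M a r : ℝ) : ℂ), 1, 0, ((a / Delk M a r : ℝ) : ℂ)]

/-- Ingoing principal null vector ñ. -/
def tildeN (M a r θ : ℝ) : Fin 4 → ℂ :=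
  ![(((r ^ 2 + a ^ 2) / (2 * Sigk a r θ) : ℝ) : ℂ),
    ((-(Delk M a r / (2 * Sigk a r θ)) : ℝ) : ℂ), 0,
    ((a / (2 * Sigk a r θ) : ℝ) : ℂ)]

/-- Complex principal tetrad vector m̃. -/
def tildeM (a r θ : ℝ) : Fin 4 → ℂ :=
  ![Complex.I * a * Real.sin θ / (Real.sqrt 2 * rfrak a r θ), 0,
    1 / (Real.sqrt 2 * rfrak a r θ),
    Complex.I / (Real.sqrt 2 * rfrak a r θ * Real.sin θ)]

/-- Componentwise complex conjugate m̄̃ of m̃. -/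
def tildeMBar (a r θ : ℝ) : Fin 4 → ℂ := fun i => (starRingEnd ℂ) (tildeM a r θ i)

lemma Sigk_eq_sub (a r θ : ℝ) : Sigk a r θ = r ^ 2 + a ^ 2 - a ^ 2 * Real.sin θ ^ 2 := by
  rw [Sigk, Real.cos_sq']
  ring

lemma Delk_eq_sub {a r θ : ℝ} (M : ℝ) (hSig : Sigk a r θ ≠ 0) :
    Delk M a r = r ^ 2 + a ^ 2 - Phik M a r θ * Sigk a r θ := by
  rw [Phik, div_mul_cancel₀ _ hSig, Delk]
  ring

lemma kerrMetric_mulVec (M a r θ : ℝ) (v : Fin 4 → ℂ) :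
    (kerrMetric M a r θ).mulVec v =
      ![(1 - Phik M a r θ) * v 0 + Phik M a r θ * a * Real.sin θ ^ 2 * v 3,
        -(Sigk a r θ / Delk M a r) * v 1,
        -Sigk a r θ * v 2,
        Phik M a r θ * a * Real.sin θ ^ 2 * v 0
          - (r ^ 2 + a ^ 2 + Phik M a r θ * a ^ 2 * Real.sin θ ^ 2) * Real.sin θ ^ 2 * v 3] := by
  ext i
  fin_cases i <;>
    simp [kerrMetric, Matrix.mulVec, dotProduct, Fin.sum_univ_four, ← sub_eq_add_neg,
      -Complex.ofReal_sin]

lemma kerrMetric_mulVec_tildeL {M a r θ : ℝ} (hSig : Sigk a r θ ≠ 0) (hDel : Delk M a r ≠ 0) :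
    (kerrMetric M a r θ).mulVec (tildeL M a r) =
      ![1, -((Sigk a r θ : ℂ) / Delk M a r), 0, -((a : ℂ) * Real.sin θ ^ 2)] := by
  have hS := congrArg (Complex.ofReal) (Sigk_eq_sub a r θ)
  have hD := congrArg (Complex.ofReal) (Delk_eq_sub M hSig)
  have hD0 : (Delk M a r : ℂ) ≠ 0 := by exact_mod_cast hDel
  rw [kerrMetric_mulVec]
  push_cast [-Complex.ofReal_sin] at hS hD
  ext i
  fin_cases i <;> simp [tildeL, -Complex.ofReal_sin] <;> field_simp
  · linear_combination -hD + (Phik M a r θ : ℂ) * hS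
  · linear_combination (a * Real.sin θ ^ 2 : ℂ) * (hD - (Phik M a r θ : ℂ) * hS)

lemma kerrMetric_mulVec_tildeN {M a r θ : ℝ} (hSig : Sigk a r θ ≠ 0) (hDel : Delk M a r ≠ 0) :
    (kerrMetric M a r θ).mulVec (tildeN M a r θ) =
      ![(Delk M a r : ℂ) / (2 * Sigk a r θ), 1 / 2, 0,
        -((a : ℂ) * Real.sin θ ^ 2 * Delk M a r / (2 * Sigk a r θ))] := by
  have hS := congrArg (Complex.ofReal) (Sigk_eq_sub a r θ)
  have hD := congrArg (Complex.ofReal) (Delk_eq_sub M hSig)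
  have hD0 : (Delk M a r : ℂ) ≠ 0 := by exact_mod_cast hDel
  have hS0 : (Sigk a r θ : ℂ) ≠ 0 := by exact_mod_cast hSig
  rw [kerrMetric_mulVec]
  push_cast [-Complex.ofReal_sin] at hS hD
  ext i
  fin_cases i <;> simp [tildeN, -Complex.ofReal_sin] <;> field_simp
  · linear_combination -hD + (Phik M a r θ : ℂ) * hS
  · linear_combination (a * Real.sin θ ^ 2 : ℂ) * (hD - (Phik M a r θ : ℂ) * hS)

/-- Lowering the index of `m̃` (with `j = i`, `K = √2 𝔯`) and of its conjugate
(with `j = -i`, `K = √2 𝔯̄`). -/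
lemma kerrMetric_mulVec_angular (M : ℝ) {a r θ : ℝ} (hsin : Real.sin θ ≠ 0) (j : ℂ) {K : ℂ}
    (hK : K ≠ 0) :
    (kerrMetric M a r θ).mulVec ![j * a * Real.sin θ / K, 0, 1 / K, j / (K * Real.sin θ)] =
      ![j * a * Real.sin θ / K, 0, -Sigk a r θ / K,
        -(j * (r ^ 2 + a ^ 2) * Real.sin θ / K)] := by
  have hs0 : (Real.sin θ : ℂ) ≠ 0 := by exact_mod_cast hsin
  rw [kerrMetric_mulVec]
  ext i
  fin_cases i <;> simp [-Complex.ofReal_sin] <;> field_simp <;> ring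

lemma tildeMBar_eq (a r θ : ℝ) :
    tildeMBar a r θ =
      ![-Complex.I * a * Real.sin θ / (Real.sqrt 2 * (starRingEnd ℂ) (rfrak a r θ)), 0,
        1 / (Real.sqrt 2 * (starRingEnd ℂ) (rfrak a r θ)),
        -Complex.I / (Real.sqrt 2 * (starRingEnd ℂ) (rfrak a r θ) * Real.sin θ)] := by
  ext i
  fin_cases i <;> simp [tildeMBar, tildeM, -Complex.ofReal_sin]

lemma rfrak_mul_conj (a r θ : ℝ) :
    rfrak a r θ * (starRingEnd ℂ) (rfrak a r θ) = Sigk a r θ := by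
  simp only [rfrak, Sigk, map_add, map_mul, Complex.conj_I, Complex.conj_ofReal]
  push_cast [-Complex.ofReal_cos]
  linear_combination (-(a : ℂ) ^ 2 * (Real.cos θ : ℂ) ^ 2) * Complex.I_sq

/-- The Kerr metric is reconstructed from the principal null tetrad:
G = ℓ̃♭ (ñ♭)ᵀ + ñ♭ (ℓ̃♭)ᵀ − m̃♭ (m̄̃♭)ᵀ − m̄̃♭ (m̃♭)ᵀ, where v♭ = G·v. -/
theorem kerr_metric_from_principal_null_tetrad (M a r θ : ℝ)
    (hSig : 0 < Sigk a r θ) (hDel : Delk M a r ≠ 0) (hsin : Real.sin θ ≠ 0)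
    (hrfrak : rfrak a r θ ≠ 0) :
    kerrMetric M a r θ =
      Matrix.vecMulVec ((kerrMetric M a r θ).mulVec (tildeL M a r))
          ((kerrMetric M a r θ).mulVec (tildeN M a r θ))
        + Matrix.vecMulVec ((kerrMetric M a r θ).mulVec (tildeN M a r θ))
          ((kerrMetric M a r θ).mulVec (tildeL M a r))
        - Matrix.vecMulVec ((kerrMetric M a r θ).mulVec (tildeM a r θ))
          ((kerrMetric M a r θ).mulVec (tildeMBar a r θ))
        - Matrix.vecMulVec ((kerrMetric M a r θ).mulVec (tildeMBar a r θ))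
          ((kerrMetric M a r θ).mulVec (tildeM a r θ)) := by
  have hSig0 := hSig.ne'
  have hS0 : (Sigk a r θ : ℂ) ≠ 0 := by exact_mod_cast hSig0
  have hD0 : (Delk M a r : ℂ) ≠ 0 := by exact_mod_cast hDel
  have h2 : (Real.sqrt 2 : ℂ) * Real.sqrt 2 = 2 := by
    exact_mod_cast Real.mul_self_sqrt zero_le_two
  have h20 : (Real.sqrt 2 : ℂ) ≠ 0 := left_ne_zero_of_mul (h2 ▸ two_ne_zero)
  have hS := congrArg (Complex.ofReal) (Sigk_eq_sub a r θ)
  have hD := congrArg (Complex.ofReal) (Delk_eq_sub M hSig0)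
  push_cast [-Complex.ofReal_sin] at hS hD
  have hK : (Real.sqrt 2 : ℂ) * rfrak a r θ ≠ 0 := mul_ne_zero h20 hrfrak
  have hK' : (Real.sqrt 2 : ℂ) * (starRingEnd ℂ) (rfrak a r θ) ≠ 0 :=
    mul_ne_zero h20 ((map_ne_zero _).2 hrfrak)
  have hKK : ((Real.sqrt 2 : ℂ) * rfrak a r θ) *
      ((Real.sqrt 2 : ℂ) * (starRingEnd ℂ) (rfrak a r θ)) = 2 * Sigk a r θ := by
    rw [mul_mul_mul_comm, h2, rfrak_mul_conj]
  rw [kerrMetric_mulVec_tildeL hSig0 hDel, kerrMetric_mulVec_tildeN hSig0 hDel, tildeMBar_eq,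
    tildeM, kerrMetric_mulVec_angular M hsin _ hK, kerrMetric_mulVec_angular M hsin _ hK']
  generalize (Real.sqrt 2 : ℂ) * rfrak a r θ = K at *
  generalize (Real.sqrt 2 : ℂ) * (starRingEnd ℂ) (rfrak a r θ) = K' at *
  obtain rfl : K' = 2 * Sigk a r θ / K := by rw [← hKK]; field_simp
  ext i k
  fin_cases i <;> fin_cases k <;>
    simp [kerrMetric, -Complex.ofReal_sin] <;>
    field_simp <;> ring_nf <;> simp only [Complex.I_sq] <;> ring_nf
  · linear_combination 2 * hS - 2 * hD
  · linear_combination (2 * a * Real.sin θ ^ 2 : ℂ) * hD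
  · linear_combination (2 * a * Real.sin θ ^ 2 : ℂ) * hD
  · linear_combination (-2 * Real.sin θ ^ 2 * (r ^ 2 + a ^ 2) : ℂ) * hS
      - (2 * Real.sin θ ^ 4 * a ^ 2 : ℂ) * hD

end Stmt1
end
end

section
/- Every vector of the Carter first-order null geodesic system is null with respect to the Kerr metric: for any real constants E, L_z, K and any signs ε_r, ε_θ ∈ {−1, 1}, if 𝓡 ≥ 0 and Θ ≥ 0 then the vector ℓ with components ℓᵗ = [E((r²+a²)² − Δ a² sin²θ) − 2aMr L_z]/(ΣΔ), ℓʳ = ε_r √𝓡/Σ, ℓ^θ = ε_θ √Θ/Σ, ℓ^φ = [2EaMr + (Σ − 2Mr) L_z/sin²θ]/(ΣΔ) satisfies g(ℓ, ℓ) = 0, for all r, θ with Σ > 0, Δ ≠ 0, sin θ ≠ 0. -/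
noncomputable section

namespace Stmt2

/-- Σ = r² + a² cos²θ -/
def Sigk (a r θ : ℝ) : ℝ := r ^ 2 + a ^ 2 * Real.cos θ ^ 2

/-- Δ = r² − 2Mr + a² -/
def Delk (M a r : ℝ) : ℝ := r ^ 2 - 2 * M * r + a ^ 2

/-- Φ = 2Mr/Σ -/
def Phik (M a r θ : ℝ) : ℝ := 2 * M * r / Sigk a r θ

/-- The Kerr metric in Boyer–Lindquist coordinates as a real symmetric 4×4 matrix
in the coordinate basis (∂_t, ∂_r, ∂_θ, ∂_φ). -/
def kerrMetric (M a r θ : ℝ) : Matrix (Fin 4) (Fin 4) ℝ :=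
  !![1 - Phik M a r θ, 0, 0, Phik M a r θ * a * Real.sin θ ^ 2;
     0, -(Sigk a r θ / Delk M a r), 0, 0;
     0, 0, -Sigk a r θ, 0;
     Phik M a r θ * a * Real.sin θ ^ 2, 0, 0,
       -((r ^ 2 + a ^ 2 + Phik M a r θ * a ^ 2 * Real.sin θ ^ 2) * Real.sin θ ^ 2)]

/-- Contraction g(v,w). -/
def gdot (G : Matrix (Fin 4) (Fin 4) ℝ) (v w : Fin 4 → ℝ) : ℝ :=
  ∑ i : Fin 4, ∑ j : Fin 4, v i * G i j * w j

/-- 𝓡 = (E(r²+a²) − aL_z)² − KΔ -/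
def Rfun (M a E Lz K r : ℝ) : ℝ :=
  (E * (r ^ 2 + a ^ 2) - a * Lz) ^ 2 - K * Delk M a r

/-- Θ = K − (L_z/sinθ − aE sinθ)² -/
def Tfun (a E Lz K θ : ℝ) : ℝ :=
  K - (Lz / Real.sin θ - a * E * Real.sin θ) ^ 2

/-- Tangent vector of the Carter first-order null geodesic system. -/
def carterVec (M a E Lz K εr εθ r θ : ℝ) : Fin 4 → ℝ :=
  ![(E * ((r ^ 2 + a ^ 2) ^ 2 - Delk M a r * a ^ 2 * Real.sin θ ^ 2) - 2 * a * M * r * Lz)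
      / (Sigk a r θ * Delk M a r),
    εr * Real.sqrt (Rfun M a E Lz K r) / Sigk a r θ,
    εθ * Real.sqrt (Tfun a E Lz K θ) / Sigk a r θ,
    (2 * E * a * M * r + (Sigk a r θ - 2 * M * r) * Lz / Real.sin θ ^ 2)
      / (Sigk a r θ * Delk M a r)]

/-- The Kerr metric in the Carter frame, where it is diagonal. -/
theorem gdot_kerrMetric_self (M a r θ : ℝ) (hSig : Sigk a r θ ≠ 0) (v : Fin 4 → ℝ) :
    gdot (kerrMetric M a r θ) v v =
      Delk M a r / Sigk a r θ * (v 0 - a * Real.sin θ ^ 2 * v 3) ^ 2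
        - Real.sin θ ^ 2 / Sigk a r θ * ((r ^ 2 + a ^ 2) * v 3 - a * v 0) ^ 2
        - Sigk a r θ / Delk M a r * v 1 ^ 2 - Sigk a r θ * v 2 ^ 2 := by
  have hr : r ^ 2 = Sigk a r θ - a ^ 2 + a ^ 2 * Real.sin θ ^ 2 := by
    unfold Sigk
    linear_combination -a ^ 2 * Real.sin_sq_add_cos_sq θ
  simp only [gdot, kerrMetric, Phik, Fin.sum_univ_four, Matrix.of_apply, Matrix.cons_val]
  generalize hX : Sigk a r θ / Delk M a r = X
  unfold Delk
  rw [hr]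
  field_simp
  ring

theorem carterVec_zero_sub (M a E Lz K εr εθ r θ : ℝ)
    (hSig : Sigk a r θ ≠ 0) (hDel : Delk M a r ≠ 0) (hsin : Real.sin θ ≠ 0) :
    carterVec M a E Lz K εr εθ r θ 0
        - a * Real.sin θ ^ 2 * carterVec M a E Lz K εr εθ r θ 3 =
      (E * (r ^ 2 + a ^ 2) - a * Lz) / Delk M a r := by
  simp only [carterVec, Matrix.cons_val]
  field_simp
  simp only [Sigk, Delk, Real.cos_sq']
  ring

theorem carterVec_three_sub (M a E Lz K εr εθ r θ : ℝ)
    (hSig : Sigk a r θ ≠ 0) (hDel : Delk M a r ≠ 0) (hsin : Real.sin θ ≠ 0) :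
    (r ^ 2 + a ^ 2) * carterVec M a E Lz K εr εθ r θ 3
        - a * carterVec M a E Lz K εr εθ r θ 0 =
      (Lz / Real.sin θ - a * E * Real.sin θ) / Real.sin θ := by
  simp only [carterVec, Matrix.cons_val]
  field_simp
  simp only [Sigk, Delk, Real.cos_sq']
  ring

/-- Every vector of the Carter first-order null geodesic system is null with
respect to the Kerr metric. -/
theorem carter_vector_is_null (M a E Lz K εr εθ r θ : ℝ)
    (hεr : εr = -1 ∨ εr = 1) (hεθ : εθ = -1 ∨ εθ = 1)
    (hR : 0 ≤ Rfun M a E Lz K r) (hT : 0 ≤ Tfun a E Lz K θ)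
    (hSig : 0 < Sigk a r θ) (hDel : Delk M a r ≠ 0) (hsin : Real.sin θ ≠ 0) :
    gdot (kerrMetric M a r θ) (carterVec M a E Lz K εr εθ r θ)
      (carterVec M a E Lz K εr εθ r θ) = 0 := by
  have hr1 : carterVec M a E Lz K εr εθ r θ 1 ^ 2 = Rfun M a E Lz K r / Sigk a r θ ^ 2 := by
    have : εr ^ 2 = 1 := by rcases hεr with rfl | rfl <;> norm_num
    simp [carterVec, div_pow, mul_pow, Real.sq_sqrt hR, this]
  have hθ2 : carterVec M a E Lz K εr εθ r θ 2 ^ 2 = Tfun a E Lz K θ / Sigk a r θ ^ 2 := by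
    have : εθ ^ 2 = 1 := by rcases hεθ with rfl | rfl <;> norm_num
    simp [carterVec, div_pow, mul_pow, Real.sq_sqrt hT, this]
  rw [gdot_kerrMetric_self M a r θ hSig.ne', hr1, hθ2,
    carterVec_zero_sub M a E Lz K εr εθ r θ hSig.ne' hDel hsin,
    carterVec_three_sub M a E Lz K εr εθ r θ hSig.ne' hDel hsin, Rfun, Tfun]
  have hSig' := hSig.ne'
  field_simp
  ring

end Stmt2
end
end

section
/- Lowering the index of the Carter null geodesic tangent vector with the Kerr metric yields the covector of conserved momenta: for real constants E, L_z, K, signs ε_r, ε_θ ∈ {−1, 1}, with 𝓡 ≥ 0 and Θ ≥ 0, the vector ℓ with components ℓᵗ = [E((r²+a²)² − Δ a² sin²θ) − 2aMr L_z]/(ΣΔ), ℓʳ = ε_r √𝓡/Σ, ℓ^θ = ε_θ √Θ/Σ, ℓ^φ = [2EaMr + (Σ − 2Mr) L_z/sin²θ]/(ΣΔ) satisfies (G·ℓ)_t = E, (G·ℓ)_r = −ε_r √𝓡/Δ, (G·ℓ)_θ = −ε_θ √Θ, (G·ℓ)_φ = −L_z, where G is the Kerr metric matrix, for all r, θ with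 Σ > 0, Δ ≠ 0, sin θ ≠ 0. -/
noncomputable section

namespace Stmt3

/-- Σ = r² + a² cos²θ -/
def Sigk (a r θ : ℝ) : ℝ := r ^ 2 + a ^ 2 * Real.cos θ ^ 2

/-- Δ = r² − 2Mr + a² -/
def Delk (M a r : ℝ) : ℝ := r ^ 2 - 2 * M * r + a ^ 2

/-- Φ = 2Mr/Σ -/
def Phik (M a r θ : ℝ) : ℝ := 2 * M * r / Sigk a r θ

/-- The Kerr metric in Boyer–Lindquist coordinates as a real symmetric 4×4 matrix
in the coordinate basis (∂_t, ∂_r, ∂_θ, ∂_φ). -/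
def kerrMetric (M a r θ : ℝ) : Matrix (Fin 4) (Fin 4) ℝ :=
  !![1 - Phik M a r θ, 0, 0, Phik M a r θ * a * Real.sin θ ^ 2;
     0, -(Sigk a r θ / Delk M a r), 0, 0;
     0, 0, -Sigk a r θ, 0;
     Phik M a r θ * a * Real.sin θ ^ 2, 0, 0,
       -((r ^ 2 + a ^ 2 + Phik M a r θ * a ^ 2 * Real.sin θ ^ 2) * Real.sin θ ^ 2)]

/-- Contraction g(v,w). -/
def gdot (G : Matrix (Fin 4) (Fin 4) ℝ) (v w : Fin 4 → ℝ) : ℝ :=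
  ∑ i : Fin 4, ∑ j : Fin 4, v i * G i j * w j

/-- 𝓡 = (E(r²+a²) − aL_z)² − KΔ -/
def Rfun (M a E Lz K r : ℝ) : ℝ :=
  (E * (r ^ 2 + a ^ 2) - a * Lz) ^ 2 - K * Delk M a r

/-- Θ = K − (L_z/sinθ − aE sinθ)² -/
def Tfun (a E Lz K θ : ℝ) : ℝ :=
  K - (Lz / Real.sin θ - a * E * Real.sin θ) ^ 2

/-- Tangent vector of the Carter first-order null geodesic system. -/
def carterVec (M a E Lz K εr εθ r θ : ℝ) : Fin 4 → ℝ :=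
  ![(E * ((r ^ 2 + a ^ 2) ^ 2 - Delk M a r * a ^ 2 * Real.sin θ ^ 2) - 2 * a * M * r * Lz)
      / (Sigk a r θ * Delk M a r),
    εr * Real.sqrt (Rfun M a E Lz K r) / Sigk a r θ,
    εθ * Real.sqrt (Tfun a E Lz K θ) / Sigk a r θ,
    (2 * E * a * M * r + (Sigk a r θ - 2 * M * r) * Lz / Real.sin θ ^ 2)
      / (Sigk a r θ * Delk M a r)]


/-- Lowering the index of the Carter null geodesic tangent vector with the Kerr
metric yields the covector of conserved momenta (E, −ε_r√𝓡/Δ, −ε_θ√Θ, −L_z). -/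
theorem carter_vector_lowered (M a E Lz K εr εθ r θ : ℝ)
    (hεr : εr = -1 ∨ εr = 1) (hεθ : εθ = -1 ∨ εθ = 1)
    (hR : 0 ≤ Rfun M a E Lz K r) (hT : 0 ≤ Tfun a E Lz K θ)
    (hSig : 0 < Sigk a r θ) (hDel : Delk M a r ≠ 0) (hsin : Real.sin θ ≠ 0) :
    (kerrMetric M a r θ).mulVec (carterVec M a E Lz K εr εθ r θ) =
      ![E, -(εr * Real.sqrt (Rfun M a E Lz K r) / Delk M a r),
        -(εθ * Real.sqrt (Tfun a E Lz K θ)), -Lz] := by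
  have hS : Sigk a r θ = r ^ 2 + a ^ 2 - a ^ 2 * Real.sin θ ^ 2 := by
    rw [Sigk, Real.cos_sq']
    ring
  have hD : Delk M a r = r ^ 2 - 2 * M * r + a ^ 2 := rfl
  have hSig' : Sigk a r θ ≠ 0 := hSig.ne'
  ext i
  fin_cases i <;>
    simp [kerrMetric, carterVec, Phik, Matrix.mulVec, dotProduct, Fin.sum_univ_four] <;>
    field_simp
  all_goals
    rw [hS, hD]
    ring

end Stmt3
end
end

section
/- Carter's constant is recovered from the contractions of the null geodesic with the principal null tetrad: with ℓ_a the covector of components (E, −ε_r √𝓡/Δ, −ε_θ √Θ, −L_z) in the basis (dt, dr, dθ, dφ), one has the exact identities ℓ_a ℓ̃ᵃ = (E(r²+a²) − a L_z − ε_r √𝓡)/Δ, ℓ_a ñᵃ = (E(r²+a²) − a L_z + ε_r √𝓡)/(2Σ), and consequently 2Σ (ℓ_a ℓ̃ᵃ)(ℓ_b ñᵇ) = K, for any sign ε_r ∈ {−1, 1}, provided 𝓡 ≥ 0, Σ > 0, Δ ≠ 0. -/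
noncomputable section

namespace Stmt4

/-- Σ = r² + a² cos²θ -/
def Sigk (a r θ : ℝ) : ℝ := r ^ 2 + a ^ 2 * Real.cos θ ^ 2

/-- Δ = r² − 2Mr + a² -/
def Delk (M a r : ℝ) : ℝ := r ^ 2 - 2 * M * r + a ^ 2

/-- 𝓡 = (E(r²+a²) − aL_z)² − KΔ -/
def Rfun (M a E Lz K r : ℝ) : ℝ :=
  (E * (r ^ 2 + a ^ 2) - a * Lz) ^ 2 - K * Delk M a r

/-- Θ = K − (L_z/sinθ − aE sinθ)² -/
def Tfun (a E Lz K θ : ℝ) : ℝ :=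
  K - (Lz / Real.sin θ - a * E * Real.sin θ) ^ 2

/-- The covector ℓ_a of the null geodesic, with components
(E, −ε_r√𝓡/Δ, −ε_θ√Θ, −L_z) in the basis (dt, dr, dθ, dφ). -/
def ellLow (M a E Lz K εr εθ r θ : ℝ) : Fin 4 → ℝ :=
  ![E, -(εr * Real.sqrt (Rfun M a E Lz K r) / Delk M a r),
    -(εθ * Real.sqrt (Tfun a E Lz K θ)), -Lz]

/-- Outgoing principal null vector ℓ̃ (real components). -/
def tildeL (M a r : ℝ) : Fin 4 → ℝ :=
  ![(r ^ 2 + a ^ 2) / Delk M a r, 1, 0, a / Delk M a r]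

/-- Ingoing principal null vector ñ (real components). -/
def tildeN (M a r θ : ℝ) : Fin 4 → ℝ :=
  ![(r ^ 2 + a ^ 2) / (2 * Sigk a r θ), -(Delk M a r / (2 * Sigk a r θ)), 0,
    a / (2 * Sigk a r θ)]

/-- Contraction ℓ_a vᵃ. -/
def contr (ω v : Fin 4 → ℝ) : ℝ := ∑ i : Fin 4, ω i * v i

/-- Carter's constant is recovered from the contractions of the null geodesic
covector with the principal null tetrad: K = 2Σ (ℓ_a ℓ̃ᵃ)(ℓ_b ñᵇ). -/
theorem carter_constant_from_contractions (M a E Lz K εr εθ r θ : ℝ)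
    (hεr : εr = -1 ∨ εr = 1)
    (hR : 0 ≤ Rfun M a E Lz K r) (hT : 0 ≤ Tfun a E Lz K θ)
    (hSig : 0 < Sigk a r θ) (hDel : Delk M a r ≠ 0) :
    contr (ellLow M a E Lz K εr εθ r θ) (tildeL M a r) =
      (E * (r ^ 2 + a ^ 2) - a * Lz - εr * Real.sqrt (Rfun M a E Lz K r))
        / Delk M a r ∧
    contr (ellLow M a E Lz K εr εθ r θ) (tildeN M a r θ) =
      (E * (r ^ 2 + a ^ 2) - a * Lz + εr * Real.sqrt (Rfun M a E Lz K r))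
        / (2 * Sigk a r θ) ∧
    2 * Sigk a r θ * (contr (ellLow M a E Lz K εr εθ r θ) (tildeL M a r)
        * contr (ellLow M a E Lz K εr εθ r θ) (tildeN M a r θ)) = K := by
  have hL : contr (ellLow M a E Lz K εr εθ r θ) (tildeL M a r) =
      (E * (r ^ 2 + a ^ 2) - a * Lz - εr * Real.sqrt (Rfun M a E Lz K r))
        / Delk M a r := by
    simp only [contr, ellLow, tildeL, Fin.sum_univ_four, Matrix.cons_val]
    ring
  have hN : contr (ellLow M a E Lz K εr εθ r θ) (tildeN M a r θ) =
      (E * (r ^ 2 + a ^ 2) - a * Lz + εr * Real.sqrt (Rfun M a E Lz K r))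
        / (2 * Sigk a r θ) := by
    simp only [contr, ellLow, tildeN, Fin.sum_univ_four, Matrix.cons_val]
    field_simp
    ring
  refine ⟨hL, hN, ?_⟩
  have hε : εr ^ 2 = 1 := by rcases hεr with rfl | rfl <;> norm_num
  have hsq : Real.sqrt (Rfun M a E Lz K r) ^ 2 =
      (E * (r ^ 2 + a ^ 2) - a * Lz) ^ 2 - K * Delk M a r := Real.sq_sqrt hR
  have hSig' : Sigk a r θ ≠ 0 := hSig.ne'
  rw [hL, hN]
  generalize Real.sqrt (Rfun M a E Lz K r) = s at hsq ⊢
  field_simp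
  linear_combination -s ^ 2 * hε - hsq

end Stmt4
end
end

section
/- The hatted Boyer–Lindquist frame is orthonormal with respect to the Kerr metric: the vectors T̂ = (1/√(1−Φ)) ∂_t, R̂ = √(Δ/Σ) ∂_r, Θ̂ = (1/√Σ) ∂_θ, Φ̂ = (√(1−Φ)/(sinθ √Δ)) ( ∂_φ − (Φ a sin²θ/(1−Φ)) ∂_t ) satisfy g(T̂,T̂) = 1, g(R̂,R̂) = g(Θ̂,Θ̂) = g(Φ̂,Φ̂) = −1, and all mixed contractions vanish, for all r, θ with Σ > 0, Δ > 0, sin θ ≠ 0 and 0 ≤ Φ < 1. -/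
noncomputable section

namespace Stmt6

/-- Σ = r² + a² cos²θ -/
def Sigk (a r θ : ℝ) : ℝ := r ^ 2 + a ^ 2 * Real.cos θ ^ 2

/-- Δ = r² − 2Mr + a² -/
def Delk (M a r : ℝ) : ℝ := r ^ 2 - 2 * M * r + a ^ 2

/-- Φ = 2Mr/Σ -/
def Phik (M a r θ : ℝ) : ℝ := 2 * M * r / Sigk a r θ

/-- The Kerr metric in Boyer–Lindquist coordinates as a real symmetric 4×4 matrix. -/
def kerrMetric (M a r θ : ℝ) : Matrix (Fin 4) (Fin 4) ℝ :=
  !![1 - Phik M a r θ, 0, 0, Phik M a r θ * a * Real.sin θ ^ 2;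
     0, -(Sigk a r θ / Delk M a r), 0, 0;
     0, 0, -Sigk a r θ, 0;
     Phik M a r θ * a * Real.sin θ ^ 2, 0, 0,
       -((r ^ 2 + a ^ 2 + Phik M a r θ * a ^ 2 * Real.sin θ ^ 2) * Real.sin θ ^ 2)]

/-- Contraction g(v,w). -/
def gdot (G : Matrix (Fin 4) (Fin 4) ℝ) (v w : Fin 4 → ℝ) : ℝ :=
  ∑ i : Fin 4, ∑ j : Fin 4, v i * G i j * w j

/-- T̂ = (1/√(1−Φ)) ∂_t -/
def hatT (M a r θ : ℝ) : Fin 4 → ℝ :=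
  ![1 / Real.sqrt (1 - Phik M a r θ), 0, 0, 0]

/-- R̂ = √(Δ/Σ) ∂_r -/
def hatR (M a r θ : ℝ) : Fin 4 → ℝ :=
  ![0, Real.sqrt (Delk M a r / Sigk a r θ), 0, 0]

/-- Θ̂ = (1/√Σ) ∂_θ -/
def hatTheta (a r θ : ℝ) : Fin 4 → ℝ :=
  ![0, 0, 1 / Real.sqrt (Sigk a r θ), 0]

/-- Φ̂ = (√(1−Φ)/(sinθ √Δ)) ( ∂_φ − (Φ a sin²θ/(1−Φ)) ∂_t ) -/
def hatPhi (M a r θ : ℝ) : Fin 4 → ℝ :=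
  ![Real.sqrt (1 - Phik M a r θ) / (Real.sin θ * Real.sqrt (Delk M a r)) *
      (-(Phik M a r θ * a * Real.sin θ ^ 2 / (1 - Phik M a r θ))), 0, 0,
    Real.sqrt (1 - Phik M a r θ) / (Real.sin θ * Real.sqrt (Delk M a r))]

/-- Δ expressed through Φ and sin θ. -/
theorem Delk_eq_of_Sigk_ne_zero {M a r θ : ℝ} (h : Sigk a r θ ≠ 0) :
    Delk M a r = (r ^ 2 + a ^ 2) * (1 - Phik M a r θ) +
      Phik M a r θ * a ^ 2 * Real.sin θ ^ 2 := by
  have hPhi : Phik M a r θ * Sigk a r θ = 2 * M * r := div_mul_cancel₀ _ h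
  rw [Sigk, Real.cos_sq'] at hPhi
  rw [Delk]
  linear_combination hPhi

/-- The hatted Boyer–Lindquist frame is orthonormal with respect to the Kerr
metric, with signature (+,−,−,−). -/
theorem hatted_frame_orthonormal (M a r θ : ℝ)
    (hSig : 0 < Sigk a r θ) (hDel : 0 < Delk M a r) (hsin : Real.sin θ ≠ 0)
    (hPhi0 : 0 ≤ Phik M a r θ) (hPhi1 : Phik M a r θ < 1) :
    gdot (kerrMetric M a r θ) (hatT M a r θ) (hatT M a r θ) = 1 ∧
    gdot (kerrMetric M a r θ) (hatR M a r θ) (hatR M a r θ) = -1 ∧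
    gdot (kerrMetric M a r θ) (hatTheta a r θ) (hatTheta a r θ) = -1 ∧
    gdot (kerrMetric M a r θ) (hatPhi M a r θ) (hatPhi M a r θ) = -1 ∧
    gdot (kerrMetric M a r θ) (hatT M a r θ) (hatR M a r θ) = 0 ∧
    gdot (kerrMetric M a r θ) (hatT M a r θ) (hatTheta a r θ) = 0 ∧
    gdot (kerrMetric M a r θ) (hatT M a r θ) (hatPhi M a r θ) = 0 ∧
    gdot (kerrMetric M a r θ) (hatR M a r θ) (hatTheta a r θ) = 0 ∧
    gdot (kerrMetric M a r θ) (hatR M a r θ) (hatPhi M a r θ) = 0 ∧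
    gdot (kerrMetric M a r θ) (hatTheta a r θ) (hatPhi M a r θ) = 0 := by
  have hlapse : 0 < 1 - Phik M a r θ := sub_pos.mpr hPhi1
  have hDelta := Delk_eq_of_Sigk_ne_zero (M := M) hSig.ne'
  have hsqrt_ratio := Real.sq_sqrt (div_pos hDel hSig).le
  have hsqrt_lapse := Real.sq_sqrt hlapse.le
  have hsqrt_Sig := Real.sq_sqrt hSig.le
  have hsqrt_Del := Real.sq_sqrt hDel.le
  have hlapse_ne := hlapse.ne'
  have hSig_ne := hSig.ne'
  have hDel_ne := hDel.ne'
  have hsl_ne := (Real.sqrt_pos.mpr hlapse).ne'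
  have hsS_ne := (Real.sqrt_pos.mpr hSig).ne'
  have hsD_ne := (Real.sqrt_pos.mpr hDel).ne'
  simp only [gdot, kerrMetric, hatT, hatR, hatTheta, hatPhi, Fin.sum_univ_four]
  generalize Phik M a r θ = p at *
  generalize Sigk a r θ = S at *
  generalize Delk M a r = D at *
  generalize Real.sin θ = s at *
  generalize √(1 - p) = u at *
  generalize √(D / S) = q at *
  generalize √S = v at *
  generalize √D = w at *
  refine ⟨?_, ?_, ?_, ?_, ?_, ?_, ?_, ?_, ?_, ?_⟩ <;> simp
  · field_simp
    linarith
  · calc q * (S / D) * q = q ^ 2 * (S / D) := by ring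
      _ = 1 := by rw [hsqrt_ratio]; field_simp
  · field_simp
    linarith
  · have hnorm : u ^ 2 * (p ^ 2 * a ^ 2 * s ^ 2 + (r ^ 2 + a ^ 2 + p * a ^ 2 * s ^ 2) * (1 - p)) =
        w ^ 2 * (1 - p) := by
      rw [hsqrt_lapse, hsqrt_Del, hDelta]
      ring
    field_simp
    linear_combination -hnorm
  · field_simp
    ring

end Stmt6
end
end
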